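/- arXiv:math/0101143 — 2 statements merged into one kernel-verified Lean document; each statement's English description precedes it below -/
import Mathlib

section
/- Let H ⊂ ℂ be a lattice, and set A = −15 ∑_{λ ∈ H∖{0}} λ^{−4} and B = −35 ∑_{λ ∈ H∖{0}} λ^{−6}. Then for every z ∈ ℂ∖H one has ((1/2)℘_H′(z))² = ℘_H(z)³ + A·℘_H(z) + B. -/
/-- A lattice in `ℂ`: the set of `ℤ`-linear combinations of two `ℝ`-linearly independent
complex numbers. -/
def IsLattice (H : Set ℂ) : Prop :=
  ∃ ω₁ ω₂ : ℂ, LinearIndependent ℝ ![ω₁, ω₂] ∧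
    H = {z : ℂ | ∃ m n : ℤ, z = m * ω₁ + n * ω₂}

/-- The Weierstrass `℘`-function of a lattice `H`. -/
noncomputable def wp (H : Set ℂ) (z : ℂ) : ℂ :=
  ((z : ℂ) ^ 2)⁻¹ + ∑' l : ↥(H \ {0}), (((z - (l : ℂ)) ^ 2)⁻¹ - (((l : ℂ)) ^ 2)⁻¹)

/-- Removing `0` from the index set does not change the sum of a function vanishing at `0`. -/
theorem tsum_subtype_sdiff_zero {α β : Type*} [Zero α] [AddCommMonoid β] [TopologicalSpace β]
    (s : Set α) {f : α → β} (hf : f 0 = 0) :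
    ∑' l : s, f l = ∑' l : ↥(s \ {0}), f l := by
  classical
  rw [tsum_subtype s f, tsum_subtype (s \ {0}) f]
  congr 1 with x
  by_cases hx : x = 0 <;> simp [Set.indicator, hx, hf]

theorem wp_lattice (L : PeriodPair) : wp (L.lattice : Set ℂ) = L.weierstrassP := by
  ext z
  have h := L.weierstrassPExcept_add 0 z
  have hs := tsum_subtype_sdiff_zero (L.lattice : Set ℂ)
    (f := fun l : ℂ ↦ if l = 0 then (0 : ℂ) else 1 / (z - l) ^ 2 - 1 / l ^ 2) (by simp)
  have hne : ∀ l : ↥((L.lattice : Set ℂ) \ {0}),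
      (if (l : ℂ) = 0 then (0 : ℂ) else 1 / (z - l) ^ 2 - 1 / (l : ℂ) ^ 2) =
        ((z - (l : ℂ)) ^ 2)⁻¹ - ((l : ℂ) ^ 2)⁻¹ := fun l ↦ by
    rw [if_neg (Set.notMem_singleton_iff.mp l.2.2), one_div, one_div]
  rw [tsum_congr hne] at hs
  rw [wp, ← hs, ← h, PeriodPair.weierstrassPExcept, add_comm]
  simp

/-- The Weierstrass differential equation `((1/2)℘′)² = ℘³ + A℘ + B`, with
`A = −15 ∑_{λ≠0} λ^{−4}` and `B = −35 ∑_{λ≠0} λ^{−6}`. -/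
theorem stmt_7 (H : Set ℂ) (hH : IsLattice H)
    (A B : ℂ)
    (hA : A = -15 * ∑' l : ↥(H \ {0}), ((l : ℂ) ^ 4)⁻¹)
    (hB : B = -35 * ∑' l : ↥(H \ {0}), ((l : ℂ) ^ 6)⁻¹)
    (z : ℂ) (hz : z ∉ H) :
    (1 / 2 * deriv (wp H) z) ^ 2 = wp H z ^ 3 + A * wp H z + B := by
  obtain ⟨ω₁, ω₂, hω, hHω⟩ := hH
  obtain ⟨L, rfl⟩ : ∃ L : PeriodPair, H = (L.lattice : Set ℂ) :=
    ⟨⟨ω₁, ω₂, hω⟩, by ext x; simp [hHω, PeriodPair.mem_lattice, eq_comm]⟩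
  have hG (n : ℕ) (hn : n ≠ 0) :
      L.G n = ∑' l : ↥((L.lattice : Set ℂ) \ {0}), ((l : ℂ) ^ n)⁻¹ :=
    tsum_subtype_sdiff_zero (L.lattice : Set ℂ) (f := fun l ↦ (l ^ n)⁻¹) (by simp [hn])
  have h := L.derivWeierstrassP_sq z hz
  rw [PeriodPair.g₂, PeriodPair.g₃, hG 4 (by norm_num), hG 6 (by norm_num)] at h
  rw [wp_lattice, PeriodPair.deriv_weierstrassP, hA, hB]
  linear_combination h / 4
end

section
/- Let H ⊂ ℂ be a lattice and let z, z₀ ∈ ℂ with z ∉ H, z₀ ∉ H, z − z₀ ∉ H and ℘_H(z) ≠ ℘_H(z₀). Setting α = ℘_H(z₀) and β = −(1/2)℘_H′(z₀), one has (℘_H′(z) − 2β)/(℘_H(z) − α) = 2·(ζ_H(z − z₀) − ζ_H(z) + ζ_H(z₀)). -/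
/-- The Weierstrass zeta function of a lattice `H`. -/
noncomputable def wzeta (H : Set ℂ) (z : ℂ) : ℂ :=
  z⁻¹ + ∑' l : ↥(H \ {0}), ((z - (l : ℂ))⁻¹ + ((l : ℂ))⁻¹ + z / (l : ℂ) ^ 2)

open Filter Topology

lemma AnalyticAt.dslope_self {f : ℂ → ℂ} {a : ℂ} (hf : AnalyticAt ℂ f a) :
    AnalyticAt ℂ (dslope f a) a := by
  obtain ⟨p, hp⟩ := hf
  exact hp.has_fpower_series_dslope_fslope.analyticAt

/-- The second order Taylor expansion of an analytic function, with analytic remainder. -/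
lemma AnalyticAt.exists_eq_taylor_two {f : ℂ → ℂ} (hf : AnalyticAt ℂ f 0) :
    ∃ g : ℂ → ℂ, AnalyticAt ℂ g 0 ∧
      ∀ z, f z = f 0 + deriv f 0 * z + deriv (deriv f) 0 / 2 * z ^ 2 + z ^ 3 * g z := by
  have dslope_eq (f : ℂ → ℂ) (z : ℂ) : f z = f 0 + z * dslope f 0 z := by
    have := sub_smul_dslope f 0 z
    simp only [sub_zero, smul_eq_mul] at this
    rw [this]
    ring
  have h₁ := hf.dslope_self
  have h₂ := h₁.dslope_self
  have hderiv : deriv f =ᶠ[𝓝 0] fun z ↦ dslope f 0 z + z * deriv (dslope f 0) z := by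
    filter_upwards [h₁.eventually_analyticAt] with z hz
    rw [show deriv f z = deriv (fun y ↦ f 0 + y * dslope f 0 y) z from
      congrArg (deriv · z) (funext (dslope_eq f)), deriv_const_add,
      deriv_fun_mul (by fun_prop) hz.differentiableAt]
    simp
  have hderiv₂ : deriv (deriv f) 0 / 2 = dslope (dslope f 0) 0 0 := by
    rw [hderiv.deriv_eq, deriv_fun_add h₁.differentiableAt
      (.fun_mul (by fun_prop) h₁.deriv.differentiableAt),
      deriv_fun_mul (by fun_prop) h₁.deriv.differentiableAt]
    simp
  refine ⟨_, h₂.dslope_self, fun z ↦ ?_⟩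
  rw [hderiv₂, ← dslope_same f 0]
  linear_combination dslope_eq f z + z * dslope_eq (dslope f 0) z +
    z ^ 2 * dslope_eq (dslope (dslope f 0) 0) z

noncomputable section

namespace PeriodPair

variable (L : PeriodPair)

/-- The Weierstrass `ζ` function of `L` without its pole at the origin. -/
def weierstrassZetaReg (z : ℂ) : ℂ :=
  ∑' l : L.lattice, if l.1 = 0 then 0 else ((z - l)⁻¹ + (l : ℂ)⁻¹ + z / (l : ℂ) ^ 2)

/-- The Weierstrass `ζ` function of `L`. -/
def weierstrassZeta (z : ℂ) : ℂ := z⁻¹ + L.weierstrassZetaReg z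

lemma weierstrassZeta_eq (z : ℂ) : L.weierstrassZeta z = z⁻¹ + L.weierstrassZetaReg z := rfl

lemma weierstrassZeta_bound {r : ℝ} (hr : 0 < r) {s : ℂ} (hs : ‖s‖ < r) {l : ℂ}
    (h : 2 * r ≤ ‖l‖) :
    ‖(s - l)⁻¹ + l⁻¹ + s / l ^ 2‖ ≤ 2 * r ^ 2 * ‖l‖ ^ (-3 : ℝ) := by
  have hl : 0 < ‖l‖ := by linarith
  have hl₀ : l ≠ 0 := norm_pos_iff.mp hl
  have hsl : s - l ≠ 0 := sub_ne_zero.mpr (by rintro rfl; linarith)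
  have hdist : ‖l‖ / 2 ≤ ‖s - l‖ := by
    rw [norm_sub_rev]
    exact .trans (by linarith) (norm_sub_norm_le l s)
  calc
    _ = ‖s ^ 2 / (l ^ 2 * (s - l))‖ := by
      congr 1
      field_simp
      ring
    _ = ‖s‖ ^ 2 / (‖l‖ ^ 2 * ‖s - l‖) := by simp
    _ ≤ r ^ 2 / (‖l‖ ^ 2 * (‖l‖ / 2)) := by gcongr
    _ = 2 * r ^ 2 / ‖l‖ ^ 3 := by field
    _ = _ := by norm_cast

lemma hasSumLocallyUniformly_weierstrassZetaReg :
    HasSumLocallyUniformly (fun (l : L.lattice) (z : ℂ) ↦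
      if l.1 = 0 then 0 else ((z - l)⁻¹ + (l : ℂ)⁻¹ + z / (l : ℂ) ^ 2))
      L.weierstrassZetaReg := by
  refine L.hasSumLocallyUniformly_aux (u := fun r l ↦ 2 * r ^ 2 * ‖l‖ ^ (-3 : ℝ)) _
    (fun _ _ ↦ (ZLattice.summable_norm_rpow _ _ (by simp; norm_num)).mul_left _) fun r hr ↦
    Filter.eventually_atTop.mpr ⟨2 * r, ?_⟩
  rintro _ h s hs l rfl
  split_ifs
  · rw [norm_zero]
    positivity
  · exact weierstrassZeta_bound hr hs h

lemma differentiableAt_weierstrassZetaReg_summand {z : ℂ} (hz : z ∈ ((L.lattice : Set ℂ) \ {0})ᶜ)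
    (l : L.lattice) :
    DifferentiableAt ℂ (fun z : ℂ ↦
      if l.1 = 0 then 0 else ((z - l)⁻¹ + (l : ℂ)⁻¹ + z / (l : ℂ) ^ 2)) z := by
  split_ifs with hl
  · simp
  · have : z - l ≠ 0 := sub_ne_zero.mpr (by rintro rfl; simp_all)
    fun_prop (disch := assumption)

lemma differentiableOn_weierstrassZetaReg :
    DifferentiableOn ℂ L.weierstrassZetaReg ((L.lattice : Set ℂ) \ {0})ᶜ :=
  L.hasSumLocallyUniformly_weierstrassZetaReg.hasSumLocallyUniformlyOn.differentiableOn
    (.of_forall fun _ ↦ .fun_sum fun l _ _ hz ↦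
      (L.differentiableAt_weierstrassZetaReg_summand hz l).differentiableWithinAt)
    L.isOpen_compl_lattice_sdiff

lemma analyticOnNhd_weierstrassZetaReg :
    AnalyticOnNhd ℂ L.weierstrassZetaReg ((L.lattice : Set ℂ) \ {0})ᶜ :=
  L.differentiableOn_weierstrassZetaReg.analyticOnNhd L.isOpen_compl_lattice_sdiff

lemma analyticAt_weierstrassZetaReg_zero : AnalyticAt ℂ L.weierstrassZetaReg 0 :=
  L.analyticOnNhd_weierstrassZetaReg 0 (by simp)

lemma deriv_weierstrassZetaReg {z : ℂ} (hz : z ∈ ((L.lattice : Set ℂ) \ {0})ᶜ) :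
    deriv L.weierstrassZetaReg z = -L.weierstrassPExcept 0 z := by
  have h := (L.hasSumLocallyUniformly_weierstrassZetaReg.tendstoLocallyUniformlyOn.deriv
    (.of_forall fun _ ↦ .fun_sum fun l _ _ hz ↦
      (L.differentiableAt_weierstrassZetaReg_summand hz l).differentiableWithinAt)
    L.isOpen_compl_lattice_sdiff).tendsto_at hz
  refine tendsto_nhds_unique h ((L.hasSum_weierstrassPExcept 0 z).neg.congr fun s ↦ ?_)
  simp only [Function.comp_apply]
  rw [deriv_fun_sum fun l _ ↦ L.differentiableAt_weierstrassZetaReg_summand hz l]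
  refine Finset.sum_congr rfl fun l _ ↦ ?_
  split_ifs with hl
  · simp
  · have hzl : z - l ≠ 0 := sub_ne_zero.mpr (by rintro rfl; simp_all)
    have := (((((hasDerivAt_id z).sub_const (l : ℂ)).inv hzl).add_const (l : ℂ)⁻¹).add
      ((hasDerivAt_id z).div_const ((l : ℂ) ^ 2))).deriv
    refine Eq.trans ?_ this.symm
    simp only [id]
    ring

lemma weierstrassZetaReg_neg (z : ℂ) : L.weierstrassZetaReg (-z) = -L.weierstrassZetaReg z := by
  rw [weierstrassZetaReg, weierstrassZetaReg, ← tsum_neg, ← (Equiv.neg L.lattice).tsum_eq]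
  refine tsum_congr fun l ↦ ?_
  simp only [Equiv.neg_apply, Submodule.coe_neg, neg_eq_zero]
  split_ifs with hl
  · simp
  · rw [← neg_sub', inv_neg, inv_neg, neg_sq, neg_div]
    ring

lemma weierstrassZeta_neg (z : ℂ) : L.weierstrassZeta (-z) = -L.weierstrassZeta z := by
  rw [weierstrassZeta, weierstrassZeta, weierstrassZetaReg_neg, inv_neg]
  ring

lemma analyticAt_weierstrassZeta {z : ℂ} (hz : z ∉ L.lattice) :
    AnalyticAt ℂ L.weierstrassZeta z := by
  have hz₀ : z ≠ 0 := by rintro rfl; simp at hz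
  exact (analyticAt_id.inv hz₀).add (L.analyticOnNhd_weierstrassZetaReg z (by simp [hz]))

lemma deriv_weierstrassZeta {z : ℂ} (hz : z ∉ L.lattice) :
    deriv L.weierstrassZeta z = -℘[L] z := by
  have hz₀ : z ≠ 0 := by rintro rfl; simp at hz
  have hz' : z ∈ ((L.lattice : Set ℂ) \ {0})ᶜ := by simp [hz]
  unfold weierstrassZeta
  rw [deriv_fun_add (differentiableAt_inv hz₀)
    (L.analyticOnNhd_weierstrassZetaReg z hz').differentiableAt,
    deriv_inv, L.deriv_weierstrassZetaReg hz', ← L.weierstrassPExcept_add 0]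
  simp

/-- The Weierstrass `ζ` function is quasi-periodic. -/
lemma exists_weierstrassZeta_add_coe (l : L.lattice) :
    ∃ η : ℂ, ∀ z ∉ L.lattice, L.weierstrassZeta (z + l) = L.weierstrassZeta z + η := by
  have hmem (z : ℂ) : z + l ∈ L.lattice ↔ z ∈ L.lattice :=
    L.lattice.toAddSubgroup.add_mem_cancel_right l.2
  refine ⟨L.weierstrassZeta (L.ω₁ / 2 + l) - L.weierstrassZeta (L.ω₁ / 2), fun z hz ↦ ?_⟩
  refine IsOpen.eqOn_of_deriv_eq (𝕜 := ℂ) (s := (L.lattice : Set ℂ)ᶜ)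
    (f := fun z ↦ L.weierstrassZeta (z + l))
    (g := fun z ↦ L.weierstrassZeta z +
      (L.weierstrassZeta (L.ω₁ / 2 + l) - L.weierstrassZeta (L.ω₁ / 2))) L.isClosed_lattice.isOpen_compl ?_ ?_ ?_ ?_
    (x := L.ω₁ / 2) L.ω₁_div_two_notMem_lattice ?_ hz
  · exact (Set.Countable.isConnected_compl_of_one_lt_rank (by simp)
      (countable_of_Lindelof_of_discrete (X := L.lattice))).2
  · intro z hz
    exact ((L.analyticAt_weierstrassZeta (mt (hmem z).mp hz)).fun_comp
      (f := (· + (l : ℂ))) (by fun_prop)).differentiableAt.differentiableWithinAt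
  · intro z hz
    exact ((L.analyticAt_weierstrassZeta hz).differentiableAt.add_const _).differentiableWithinAt
  · intro z hz
    rw [deriv_comp_add_const, deriv_add_const, L.deriv_weierstrassZeta hz,
      L.deriv_weierstrassZeta (mt (hmem z).mp hz), weierstrassP_add_coe]
  · ring

/-- The defect of the addition formula, as a function of `z`, extended by zero to the points
where the formula has no meaning. -/
def zetaAdditionDefect (w z : ℂ) : ℂ :=
  open Classical in
  if z ∈ L.lattice ∨ z - w ∈ L.lattice then 0 else
    2 * (L.weierstrassZeta (z - w) - L.weierstrassZeta z + L.weierstrassZeta w) *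
      (℘[L] z - ℘[L] w) - ℘'[L] z - ℘'[L] w

lemma zetaAdditionDefect_add_coe (w z : ℂ) (l : L.lattice) :
    L.zetaAdditionDefect w (z + l) = L.zetaAdditionDefect w z := by
  have hmem (z : ℂ) : z + l ∈ L.lattice ↔ z ∈ L.lattice :=
    L.lattice.toAddSubgroup.add_mem_cancel_right l.2
  rw [zetaAdditionDefect, zetaAdditionDefect, add_sub_right_comm z]
  by_cases h : z ∈ L.lattice ∨ z - w ∈ L.lattice
  · rw [if_pos h, if_pos (by rwa [hmem, hmem])]
  · rw [if_neg h, if_neg (by rwa [hmem, hmem])]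
    push Not at h
    obtain ⟨η, hη⟩ := L.exists_weierstrassZeta_add_coe l
    rw [hη z h.1, hη _ h.2, weierstrassP_add_coe, derivWeierstrassP_add_coe]
    ring

lemma analyticAt_zetaAdditionDefect_zero {w : ℂ} (hw : w ∉ L.lattice) :
    AnalyticAt ℂ (L.zetaAdditionDefect w) 0 := by
  have hnw : -w ∉ L.lattice := by simpa using hw
  let f : ℂ → ℂ := fun z ↦ L.weierstrassZeta (z - w) + L.weierstrassZeta w
  have hf : AnalyticAt ℂ f 0 := by
    refine .add (.fun_comp (g := L.weierstrassZeta) ?_ (by fun_prop)) analyticAt_const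
    simpa using L.analyticAt_weierstrassZeta hnw
  have hcompl : ∀ᶠ z : ℂ in 𝓝 0, z - w ∉ L.lattice :=
    ContinuousAt.eventually_mem (f := fun z : ℂ ↦ z - w) (by fun_prop)
      (L.isClosed_lattice.isOpen_compl.mem_nhds (by simpa using hw))
  have hcompl₀ : ∀ᶠ z : ℂ in 𝓝 0, z ∈ ((L.lattice : Set ℂ) \ {0})ᶜ :=
    L.compl_lattice_sdiff_singleton_mem_nhds 0
  have hf₀ : f 0 = 0 := by simp [f, weierstrassZeta_neg]
  have hf' : deriv f =ᶠ[𝓝 0] fun z ↦ -℘[L] (z - w) := by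
    filter_upwards [hcompl] with z hz
    simp only [f, deriv_add_const']
    rw [deriv_comp_sub_const, L.deriv_weierstrassZeta hz]
  have hf₁ : deriv f 0 = -℘[L] w := by simp [hf'.eq_of_nhds]
  have hf₂ : deriv (deriv f) 0 = ℘'[L] w := by
    rw [hf'.deriv_eq, deriv.fun_neg, deriv_comp_sub_const, deriv_weierstrassP]
    simp
  obtain ⟨R, hR, hfR⟩ := hf.exists_eq_taylor_two
  have hZ := L.analyticAt_weierstrassZetaReg_zero
  have hZ₀ : L.weierstrassZetaReg 0 = 0 := by
    simpa [self_eq_neg] using L.weierstrassZetaReg_neg 0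
  have hZ' : deriv L.weierstrassZetaReg =ᶠ[𝓝 0] fun z ↦ -L.weierstrassPExcept 0 z := by
    filter_upwards [hcompl₀] with z hz
    exact L.deriv_weierstrassZetaReg hz
  have hZ₁ : deriv L.weierstrassZetaReg 0 = 0 := by simp [hZ'.eq_of_nhds]
  have hZ₂ : deriv (deriv L.weierstrassZetaReg) 0 = 0 := by
    rw [hZ'.deriv_eq, deriv.fun_neg]
    simp
  obtain ⟨S, hS, hZS⟩ := hZ.exists_eq_taylor_two
  obtain ⟨T, hT, hPT⟩ := (L.analyticAt_weierstrassPExcept 0).exists_eq_taylor_two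
  simp only [hf₀, hf₁, hf₂] at hfR
  simp only [hZ₀, hZ₁, hZ₂] at hZS
  simp only [weierstrassPExcept_zero, deriv_weierstrassPExcept_same,
    derivWeierstrassPExcept_zero_zero] at hPT
  set c := deriv (deriv (L.weierstrassPExcept 0)) 0 / 2
  have hP' := L.analyticAt_derivWeierstrassPExcept 0
  have key : AnalyticAt ℂ (fun z ↦ 2 * z * (R z - S z - c - z * T z) +
      2 * (-℘[L] w * z + ℘'[L] w / 2 * z ^ 2 + z ^ 3 * (R z - S z)) *
        (c * z ^ 2 + z ^ 3 * T z - ℘[L] w) - L.derivWeierstrassPExcept 0 z) 0 := by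
    fun_prop
  refine key.congr ?_
  filter_upwards [hcompl, hcompl₀] with z hzw hz
  obtain rfl | hz₀ := eq_or_ne z 0
  · simp [zetaAdditionDefect]
  have hzL : z ∉ L.lattice := by simpa [hz₀] using hz
  have hz1 : L.weierstrassZeta (z - w) + L.weierstrassZeta w = _ := hfR z
  have hz2 := L.weierstrassPExcept_add 0 z
  have hz3 := L.derivWeierstrassPExcept_sub 0 z
  simp only [Submodule.coe_zero, sub_zero] at hz2 hz3
  rw [zetaAdditionDefect, if_neg (by tauto), sub_add_eq_add_sub, hz1, ← hz3,
    show ℘[L] z - ℘[L] w = c * z ^ 2 + z ^ 3 * T z + 1 / z ^ 2 - ℘[L] w by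
      rw [← hz2, hPT]; simp,
    weierstrassZeta, hZS]
  field_simp
  ring

lemma analyticAt_zetaAdditionDefect_self {w : ℂ} (hw : w ∉ L.lattice) :
    AnalyticAt ℂ (L.zetaAdditionDefect w) w := by
  have hP := L.analyticOnNhd_weierstrassP w hw
  have hP' := L.analyticOnNhd_derivWeierstrassP w hw
  have hζ := L.analyticAt_weierstrassZeta hw
  have hZ : AnalyticAt ℂ (fun z ↦ L.weierstrassZetaReg (z - w)) w := by
    refine .fun_comp (g := L.weierstrassZetaReg) ?_ (by fun_prop)
    simpa using L.analyticAt_weierstrassZetaReg_zero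
  have hD : AnalyticAt ℂ (dslope ℘[L] w) w := hP.dslope_self
  have key : AnalyticAt ℂ (fun z ↦ 2 * dslope ℘[L] w z +
      2 * (L.weierstrassZetaReg (z - w) - L.weierstrassZeta z + L.weierstrassZeta w) *
        (℘[L] z - ℘[L] w) - ℘'[L] z - ℘'[L] w) w := by
    fun_prop
  have hcompl : ∀ᶠ z : ℂ in 𝓝 w, z - w ∈ ((L.lattice : Set ℂ) \ {0})ᶜ :=
    ContinuousAt.eventually_mem (f := fun z : ℂ ↦ z - w) (by fun_prop)
      (by simpa using L.compl_lattice_sdiff_singleton_mem_nhds 0)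
  refine key.congr ?_
  filter_upwards [hcompl, L.isClosed_lattice.isOpen_compl.mem_nhds hw] with z hz hzL
  obtain rfl | hzw := eq_or_ne z w
  · simp [zetaAdditionDefect]
    ring
  have hzw' : z - w ≠ 0 := sub_ne_zero.mpr hzw
  have hzw'' : z - w ∉ L.lattice := by simpa [hzw'] using hz
  rw [zetaAdditionDefect, if_neg (by simp_all), L.weierstrassZeta_eq (z - w),
    dslope_of_ne _ hzw, slope_def_field]
  field_simp
  ring

lemma analyticAt_zetaAdditionDefect {w : ℂ} (hw : w ∉ L.lattice) (z : ℂ) :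
    AnalyticAt ℂ (L.zetaAdditionDefect w) z := by
  have translate (a : ℂ) (ha : AnalyticAt ℂ (L.zetaAdditionDefect w) a) (hz : z - a ∈ L.lattice) :
      AnalyticAt ℂ (L.zetaAdditionDefect w) z := by
    rw [← sub_sub_cancel z a] at ha
    convert ha.comp (f := (· - (z - a))) (by fun_prop)
    ext y
    simpa using L.zetaAdditionDefect_add_coe w (y - (z - a)) ⟨z - a, hz⟩
  by_cases hz : z ∈ L.lattice
  · exact translate 0 (L.analyticAt_zetaAdditionDefect_zero hw) (by simpa using hz)
  by_cases hzw : z - w ∈ L.lattice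
  · exact translate w (L.analyticAt_zetaAdditionDefect_self hw) hzw
  have hP := L.analyticOnNhd_weierstrassP z hz
  have hP' := L.analyticOnNhd_derivWeierstrassP z hz
  have hζ := L.analyticAt_weierstrassZeta hz
  have hζw : AnalyticAt ℂ (fun z ↦ L.weierstrassZeta (z - w)) z :=
    .fun_comp (L.analyticAt_weierstrassZeta hzw) (by fun_prop)
  have key : AnalyticAt ℂ (fun z ↦
      2 * (L.weierstrassZeta (z - w) - L.weierstrassZeta z + L.weierstrassZeta w) *
        (℘[L] z - ℘[L] w) - ℘'[L] z - ℘'[L] w) z := by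
    fun_prop
  have hcompl : ∀ᶠ y : ℂ in 𝓝 z, y - w ∉ L.lattice :=
    ContinuousAt.eventually_mem (f := fun z : ℂ ↦ z - w) (by fun_prop)
      (L.isClosed_lattice.isOpen_compl.mem_nhds hzw)
  refine key.congr ?_
  filter_upwards [hcompl, L.isClosed_lattice.isOpen_compl.mem_nhds hz] with y hyw hy
  rw [zetaAdditionDefect, if_neg (by simp_all)]

lemma zetaAdditionDefect_eq_zero {w : ℂ} (hw : w ∉ L.lattice) (z : ℂ) :
    L.zetaAdditionDefect w z = 0 := by
  have hd : Differentiable ℂ (L.zetaAdditionDefect w) :=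
    fun z ↦ (L.analyticAt_zetaAdditionDefect hw z).differentiableAt
  refine (hd.apply_eq_apply_of_bounded (IsZLattice.isCompact_range_of_periodic L.lattice _
    hd.continuous fun z l hl ↦ L.zetaAdditionDefect_add_coe w z ⟨l, hl⟩).isBounded z 0).trans ?_
  simp [zetaAdditionDefect]

/-- The addition formula relating `ζ`, `℘` and `℘'`. -/
lemma weierstrassZeta_addition {z w : ℂ} (hz : z ∉ L.lattice) (hw : w ∉ L.lattice)
    (hzw : z - w ∉ L.lattice) :
    2 * (L.weierstrassZeta (z - w) - L.weierstrassZeta z + L.weierstrassZeta w) *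
      (℘[L] z - ℘[L] w) = ℘'[L] z + ℘'[L] w := by
  have := L.zetaAdditionDefect_eq_zero hw z
  rw [zetaAdditionDefect, if_neg (by tauto)] at this
  linear_combination this

lemma tsum_lattice_sdiff_zero (f : ℂ → ℂ) :
    ∑' l : ↥((L.lattice : Set ℂ) \ {0}), f l =
      ∑' l : L.lattice, if l.1 = 0 then 0 else f l := by
  rw [tsum_subtype ((L.lattice : Set ℂ) \ {0}) f]
  refine Eq.trans ?_ (tsum_subtype (L.lattice : Set ℂ) fun l ↦ if l = 0 then 0 else f l).symm
  congr 1 with x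
  by_cases hx : x = 0 <;> by_cases hxL : x ∈ L.lattice <;> simp [hx, hxL]

lemma wzeta_lattice : wzeta L.lattice = L.weierstrassZeta := by
  ext z
  rw [wzeta, weierstrassZeta, weierstrassZetaReg,
    L.tsum_lattice_sdiff_zero fun l ↦ (z - l)⁻¹ + l⁻¹ + z / l ^ 2]

lemma wp_lattice : wp L.lattice = ℘[L] := by
  ext z
  rw [wp, L.tsum_lattice_sdiff_zero fun l ↦ ((z - l) ^ 2)⁻¹ - (l ^ 2)⁻¹,
    ← L.weierstrassPExcept_add 0, weierstrassPExcept]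
  simp [add_comm]

end PeriodPair

end

lemma IsLattice.exists_periodPair {H : Set ℂ} (hH : IsLattice H) :
    ∃ L : PeriodPair, H = L.lattice := by
  obtain ⟨ω₁, ω₂, hω, rfl⟩ := hH
  refine ⟨⟨ω₁, ω₂, hω⟩, Set.ext fun z ↦ ?_⟩
  simp [PeriodPair.mem_lattice, eq_comm]

/-- The addition-type identity
`(℘_H′(z) − 2β)/(℘_H(z) − α) = 2(ζ_H(z − z₀) − ζ_H(z) + ζ_H(z₀))`, where `α = ℘_H(z₀)`
and `β = −(1/2)℘_H′(z₀)`. -/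
theorem stmt_12 (H : Set ℂ) (hH : IsLattice H) (z z₀ : ℂ)
    (hz : z ∉ H) (hz₀ : z₀ ∉ H) (hzz₀ : z - z₀ ∉ H)
    (hne : wp H z ≠ wp H z₀)
    (α β : ℂ) (hα : α = wp H z₀) (hβ : β = -(1 / 2) * deriv (wp H) z₀) :
    (deriv (wp H) z - 2 * β) / (wp H z - α) =
      2 * (wzeta H (z - z₀) - wzeta H z + wzeta H z₀) := by
  obtain ⟨L, rfl⟩ := hH.exists_periodPair
  rw [SetLike.mem_coe] at hz hz₀ hzz₀
  rw [L.wp_lattice] at *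
  rw [L.wzeta_lattice, hα, hβ, L.deriv_weierstrassP, div_eq_iff (sub_ne_zero.mpr hne),
    L.weierstrassZeta_addition hz hz₀ hzz₀]
  ring
end
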